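/- arXiv:quant-ph/0503092 — 5 statements merged into one kernel-verified Lean document; each statement's English description precedes it below -/
import Mathlib

section
/- Let n ≥ 3 and let Q = I − (1/n)·w w* be the orthogonal projection of ℂⁿ⊗ℂⁿ onto the orthogonal complement of the canonical maximally entangled vector w = Σ_{i=1}^n e_i⊗e_i. Then there exists no orthonormal basis {u_1,…,u_{n²−1}} of the range of Q that is perfectly distinguished by a rank-one separable measurement; that is, there do not exist vectors a_1,…,a_N, b_1,…,b_N ∈ ℂⁿ with Σ_{i=1}^N a_i a_i* ⊗ \bar{b_i} b_iᵀ = I and a pairwise-disjoint partition S_1 ∪ ⋯ ∪ S_{n²−1} = {1,…,N} such that u_k* (Σ_{i∈S_l} a_i a_i* ⊗ \bar{b_i} b_iᵀ) u_k = δ_{kl} for all 1 ≤ k,l ≤ n²−1. -/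
open Matrix Kronecker BigOperators

noncomputable section

/-- The product vector `a ⊗ conj b` in `ℂⁿ ⊗ ℂⁿ ≅ ℂ^{n²}`. -/
def prodVec {n : ℕ} (a b : Fin n → ℂ) : Fin n × Fin n → ℂ :=
  fun p => a p.1 * (starRingEnd ℂ) (b p.2)

/-- The (unnormalized) canonical maximally entangled vector `w = ∑ e_i ⊗ e_i`. -/
def maxEnt (n : ℕ) : Fin n × Fin n → ℂ := fun p => if p.1 = p.2 then 1 else 0

/-- The orthogonal projection `Q = I - (1/n) w w*` onto the orthogonal complement of `w`. -/
def Qproj (n : ℕ) : Matrix (Fin n × Fin n) (Fin n × Fin n) ℂ :=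
  1 - (1 / (n : ℂ)) • Matrix.vecMulVec (maxEnt n) (star (maxEnt n))

/-- The measurement operator `a a* ⊗ conj(b) bᵀ` on `ℂⁿ ⊗ ℂⁿ ≅ ℂ^{n²}`. -/
def meas {n : ℕ} (a b : Fin n → ℂ) : Matrix (Fin n × Fin n) (Fin n × Fin n) ℂ :=
  Matrix.vecMulVec a (star a) ⊗ₖ Matrix.vecMulVec (star b) b

lemma meas_eq {n : ℕ} (a b : Fin n → ℂ) :
    meas a b = Matrix.vecMulVec (prodVec a b) (star (prodVec a b)) := by
  ext p q
  simp [meas, prodVec, Matrix.vecMulVec_apply, Matrix.kroneckerMap_apply]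
  ring

lemma quad_zero {ι : Type*} {m : Type*} [Fintype m] (S : Finset ι) (v : ι → m → ℂ) (u : m → ℂ)
    (h : star u ⬝ᵥ ((∑ i ∈ S, Matrix.vecMulVec (v i) (star (v i))) *ᵥ u) = 0) :
    ∀ i ∈ S, star u ⬝ᵥ v i = 0 := by
  have h1 : ∀ i, star u ⬝ᵥ (Matrix.vecMulVec (v i) (star (v i)) *ᵥ u)
      = ((Complex.normSq (star u ⬝ᵥ v i) : ℝ) : ℂ) := by
    intro i
    have h2 : star (v i) ⬝ᵥ u = (starRingEnd ℂ) (star u ⬝ᵥ v i) := by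
      have := Matrix.star_dotProduct (v i) u
      rw [this]
      rfl
    rw [Matrix.vecMulVec_mulVec, h2]
    simp [Complex.normSq_eq_conj_mul_self, mul_comm]
  rw [Matrix.sum_mulVec, dotProduct_sum] at h
  simp only [h1] at h
  have h3 : ∑ i ∈ S, Complex.normSq (star u ⬝ᵥ v i) = 0 := by exact_mod_cast h
  rw [Finset.sum_eq_zero_iff_of_nonneg (fun i _ => Complex.normSq_nonneg _)] at h3
  intro i hi
  exact Complex.normSq_eq_zero.mp (h3 i hi)

lemma rank_arg {n : ℕ} (hn : 3 ≤ n) (a b a' b' : Fin n → ℂ) (c γ : ℂ)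
    (h : prodVec a b = c • prodVec a' b' + γ • maxEnt n) : γ = 0 := by
  have key : ∀ p q : Fin n, (if p = q then γ else 0) =
      a p * (starRingEnd ℂ) (b q) - c * (a' p * (starRingEnd ℂ) (b' q)) := by
    intro p q
    have := congrFun h (p, q)
    simp only [prodVec, maxEnt, Pi.add_apply, Pi.smul_apply, smul_eq_mul, mul_ite, mul_one,
      mul_zero] at this
    rw [this]; ring
  let f : Fin 3 → Fin n := Fin.castLE hn
  have h00 := key (f 0) (f 0)
  have h01 := key (f 0) (f 1)
  have h02 := key (f 0) (f 2)
  have h10 := key (f 1) (f 0)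
  have h11 := key (f 1) (f 1)
  have h12 := key (f 1) (f 2)
  have h20 := key (f 2) (f 0)
  have h21 := key (f 2) (f 1)
  have h22 := key (f 2) (f 2)
  have e : ∀ i j : Fin 3, f i = f j ↔ i = j := fun i j => (Fin.castLE_injective hn).eq_iff
  simp only [e] at h00 h01 h02 h10 h11 h12 h20 h21 h22
  have hd : ∀ m00 m01 m02 m10 m11 m12 m20 m21 m22 : ℂ,
      m00 = γ → m01 = 0 → m02 = 0 → m10 = 0 → m11 = γ → m12 = 0 → m20 = 0 → m21 = 0 → m22 = γ →
      γ ^ 3 = m00 * (m11 * m22 - m12 * m21) - m01 * (m10 * m22 - m12 * m20)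
        + m02 * (m10 * m21 - m11 * m20) := by
    intro m00 m01 m02 m10 m11 m12 m20 m21 m22 g1 g2 g3 g4 g5 g6 g7 g8 g9
    rw [g1, g2, g3, g4, g5, g6, g7, g8, g9]; ring
  have h3 := hd _ _ _ _ _ _ _ _ _ h00.symm h01.symm h02.symm h10.symm h11.symm h12.symm
    h20.symm h21.symm h22.symm
  have h4 : γ ^ 3 = 0 := by rw [h3]; ring
  exact pow_eq_zero_iff (by norm_num) |>.mp h4

lemma orth_w {n : ℕ} (hn : 3 ≤ n) (u : Fin n × Fin n → ℂ) (h : Qproj n *ᵥ u = u) :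
    star (maxEnt n) ⬝ᵥ u = 0 := by
  have h0 := congrFun h (⟨0, by omega⟩, ⟨0, by omega⟩)
  have hn0 : (n : ℂ) ≠ 0 := by exact_mod_cast (by omega : n ≠ 0)
  rw [Qproj, Matrix.sub_mulVec, Matrix.smul_mulVec, Matrix.vecMulVec_mulVec] at h0
  simp [maxEnt, hn0] at h0
  exact h0

lemma compl_w {n : ℕ} (hn : 3 ≤ n) (u : Fin (n ^ 2 - 1) → (Fin n × Fin n → ℂ))
    (ho : ∀ k l, star (u k) ⬝ᵥ u l = if k = l then (1 : ℂ) else 0)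
    (hw : ∀ k, star (u k) ⬝ᵥ maxEnt n = 0) (x : Fin n × Fin n → ℂ)
    (hx : ∀ k, star (u k) ⬝ᵥ x = 0) : ∃ β : ℂ, x = β • maxEnt n := by
  let T : (Fin n × Fin n → ℂ) →ₗ[ℂ] (Fin (n ^ 2 - 1) → ℂ) :=
    Matrix.mulVecLin (Matrix.of fun k => star (u k))
  have hT : ∀ y k, T y k = star (u k) ⬝ᵥ y := fun y k => rfl
  have hsurj : Function.Surjective T := by
    intro c
    refine ⟨∑ k, c k • u k, ?_⟩
    ext l
    rw [hT, dotProduct_sum]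
    simp [dotProduct_smul, ho]
  have hr := LinearMap.finrank_range_add_finrank_ker T
  rw [LinearMap.range_eq_top.mpr hsurj, finrank_top] at hr
  simp only [Module.finrank_fintype_fun_eq_card, Fintype.card_fin, Fintype.card_prod] at hr
  have hpos : 0 < n ^ 2 := by positivity
  have hk : Module.finrank ℂ (LinearMap.ker T) = 1 := by
    have : n * n = n ^ 2 := by ring
    omega
  let w : LinearMap.ker T := ⟨maxEnt n, by
    rw [LinearMap.mem_ker]; ext k; rw [hT, hw]; rfl⟩
  have hw0 : w ≠ 0 := by
    intro h
    have h1 : maxEnt n = 0 := congrArg Subtype.val h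
    have := congrFun h1 (⟨0, by omega⟩, ⟨0, by omega⟩)
    simp [maxEnt] at this
  obtain ⟨β, hβ⟩ := (finrank_eq_one_iff_of_nonzero' w hw0).mp hk ⟨x, by
    rw [LinearMap.mem_ker]; ext k; rw [hT, hx]; rfl⟩
  exact ⟨β, (congrArg Subtype.val hβ).symm⟩

/-- There is no orthonormal basis `u` of the range of `Q` (an orthonormal family of
`n² - 1` vectors fixed by `Q`) that is perfectly distinguished by a rank-one separable
measurement: i.e. by vectors `a_i, b_i` with `∑ a_i a_i* ⊗ conj(b_i) b_iᵀ = I` together with a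
pairwise-disjoint partition `S` of the outcomes with
`u_k* (∑_{i ∈ S_l} a_i a_i* ⊗ conj(b_i) b_iᵀ) u_k = δ_{k l}`. -/
theorem stmt0 (n : ℕ) (hn : 3 ≤ n) :
    ¬ ∃ u : Fin (n ^ 2 - 1) → (Fin n × Fin n → ℂ),
      (∀ k l, star (u k) ⬝ᵥ u l = if k = l then (1 : ℂ) else 0) ∧
      (∀ k, Qproj n *ᵥ u k = u k) ∧
      ∃ (N : ℕ) (a b : Fin N → (Fin n → ℂ)) (S : Fin (n ^ 2 - 1) → Finset (Fin N)),
        (∑ i, meas (a i) (b i) = (1 : Matrix (Fin n × Fin n) (Fin n × Fin n) ℂ)) ∧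
        (∀ k l, k ≠ l → Disjoint (S k) (S l)) ∧
        (∀ i : Fin N, ∃ k, i ∈ S k) ∧
        (∀ k l, star (u k) ⬝ᵥ ((∑ i ∈ S l, meas (a i) (b i)) *ᵥ u k)
            = if k = l then (1 : ℂ) else 0) := by
  rintro ⟨u, ho, hQ, N, a, b, S, hsum, -, hcov, hdist⟩
  have hw : ∀ k, star (u k) ⬝ᵥ maxEnt n = 0 := by
    intro k
    rw [Matrix.star_dotProduct, orth_w hn (u k) (hQ k), star_zero]
  simp only [meas_eq] at hsum hdist
  -- each product vector lies in the span of `u k` and `w`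
  have hspan : ∀ k, ∀ i ∈ S k, ∃ α β : ℂ,
      prodVec (a i) (b i) = α • u k + β • maxEnt n := by
    intro k i hi
    have hz : ∀ l, l ≠ k → star (u l) ⬝ᵥ prodVec (a i) (b i) = 0 := by
      intro l hl
      refine quad_zero (S k) (fun i => prodVec (a i) (b i)) (u l) ?_ i hi
      rw [hdist l k, if_neg hl]
    obtain ⟨β, hβ⟩ := compl_w hn u ho hw
      (prodVec (a i) (b i) - (star (u k) ⬝ᵥ prodVec (a i) (b i)) • u k) (by
        intro l
        rw [dotProduct_sub, dotProduct_smul, ho]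
        by_cases hl : l = k
        · subst hl; simp
        · simp [hl, hz l hl])
    exact ⟨_, β, by rw [← hβ]; abel⟩
  -- all product vectors of one class are proportional
  have hprop : ∀ k, ∃ y : Fin n × Fin n → ℂ, ∀ i ∈ S k, ∃ c : ℂ,
      prodVec (a i) (b i) = c • y := by
    intro k
    by_cases hall : ∀ i ∈ S k, prodVec (a i) (b i) = 0
    · exact ⟨0, fun i hi => ⟨0, by rw [hall i hi]; simp⟩⟩
    · push Not at hall
      obtain ⟨i, hi, hne⟩ := hall
      obtain ⟨α, β, hαβ⟩ := hspan k i hi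
      have hα : α ≠ 0 := by
        rintro rfl
        have h0 : β = 0 := rank_arg hn (a i) (b i) 0 0 0 β (by rw [hαβ]; simp)
        apply hne
        rw [hαβ, h0]; simp
      refine ⟨prodVec (a i) (b i), fun j hj => ?_⟩
      obtain ⟨α', β', hj'⟩ := hspan k j hj
      have hrel : prodVec (a j) (b j) = (α' / α) • prodVec (a i) (b i)
          + (β' - α' / α * β) • maxEnt n := by
        rw [hj', hαβ]
        ext p
        simp only [Pi.add_apply, Pi.smul_apply, smul_eq_mul]
        field_simp
        ring
      refine ⟨α' / α, ?_⟩
      have h0 := rank_arg hn _ _ _ _ _ _ hrel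
      rw [h0, zero_smul, add_zero] at hrel
      exact hrel
  choose y hy using hprop
  have htop : Submodule.span ℂ (Set.range y) = ⊤ := by
    rw [eq_top_iff]
    intro x _
    have hx : x = ∑ i, (star (prodVec (a i) (b i)) ⬝ᵥ x) • prodVec (a i) (b i) := by
      conv_lhs => rw [← Matrix.one_mulVec x, ← hsum, Matrix.sum_mulVec]
      refine Finset.sum_congr rfl fun i _ => ?_
      rw [Matrix.vecMulVec_mulVec]
      simp
    rw [hx]
    refine Submodule.sum_mem _ fun i _ => Submodule.smul_mem _ _ ?_
    obtain ⟨k, hk⟩ := hcov i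
    obtain ⟨c, hc⟩ := hy k i hk
    rw [hc]
    exact Submodule.smul_mem _ _ (Submodule.subset_span ⟨k, rfl⟩)
  have hle : (Set.range y).finrank ℂ ≤ _ := finrank_range_le_card (R := ℂ) y
  rw [Set.finrank, htop, finrank_top] at hle
  simp only [Module.finrank_fintype_fun_eq_card, Fintype.card_fin, Fintype.card_prod] at hle
  have hpos : 0 < n ^ 2 := by positivity
  have : n * n = n ^ 2 := by ring
  omega
end
end

section
/- Let n ≥ 1 and suppose a_1,…,a_N, b_1,…,b_N ∈ ℂⁿ satisfy Σ_{i=1}^N a_i a_i* ⊗ \bar{b_i} b_iᵀ = I on ℂⁿ⊗ℂⁿ. Then Σ_{i=1}^N ⟨a_i, b_i⟩ · a_i b_i* = I_n, where I_n is the identity on ℂⁿ. -/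
open Matrix Kronecker BigOperators

noncomputable section

/-- The standard inner product on `ℂⁿ`, conjugate-linear in the first argument. -/
def cip {n : ℕ} (a b : Fin n → ℂ) : ℂ := star a ⬝ᵥ b

theorem stmt3 (n N : ℕ) (hn : 1 ≤ n) (a b : Fin N → (Fin n → ℂ))
    (hsum : ∑ i, meas (a i) (b i) = (1 : Matrix (Fin n × Fin n) (Fin n × Fin n) ℂ)) :
    ∑ i, cip (a i) (b i) • Matrix.vecMulVec (a i) (star (b i))
      = (1 : Matrix (Fin n) (Fin n) ℂ) := by
  ext p q
  have h : ∀ r : Fin n, ∑ i, meas (a i) (b i) (p, q) (r, r)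
      = (1 : Matrix (Fin n × Fin n) (Fin n × Fin n) ℂ) (p, q) (r, r) := by
    intro r
    rw [← hsum, Matrix.sum_apply]
  have h2 : ∑ r : Fin n, ∑ i, meas (a i) (b i) (p, q) (r, r)
      = (1 : Matrix (Fin n) (Fin n) ℂ) p q := by
    rw [Finset.sum_congr rfl (fun r _ => h r)]
    simp only [Matrix.one_apply, Prod.mk.injEq]
    by_cases hpq : p = q
    · subst hpq
      simp
    · rw [if_neg hpq]
      apply Finset.sum_eq_zero
      intro r _
      rw [if_neg]
      rintro ⟨h1, h3⟩
      exact hpq (h1.trans h3.symm)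
  rw [← h2, Finset.sum_comm, Matrix.sum_apply]
  apply Finset.sum_congr rfl
  intro i _
  simp only [meas, cip, Matrix.smul_apply, Matrix.kroneckerMap_apply, Matrix.vecMulVec_apply,
    dotProduct, smul_eq_mul, Finset.sum_mul]
  apply Finset.sum_congr rfl
  intro r _
  ring
end
end

section
/- Let n ≥ 2, let Q = I − (1/n)·w w* where w = Σ_{i=1}^n e_i⊗e_i ∈ ℂⁿ⊗ℂⁿ, and suppose a_1,…,a_N, b_1,…,b_N ∈ ℂⁿ satisfy Σ_{i=1}^N a_i a_i* ⊗ \bar{b_i} b_iᵀ = I. Then there exist indices i ≠ j such that α_{i,j} := (a_i* ⊗ b_iᵀ) Q (a_j ⊗ \bar{b_j}) ≠ 0; equivalently, ⟨a_i,a_j⟩⟨b_j,b_i⟩ − (1/n)⟨a_i,b_i⟩⟨b_j,a_j⟩ ≠ 0 for some i ≠ j. -/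
open Matrix Kronecker BigOperators

noncomputable section

lemma star_maxEnt (n : ℕ) : star (maxEnt n) = maxEnt n := by
  ext p
  simp [maxEnt]

lemma maxEnt_dot (n : ℕ) (v : Fin n × Fin n → ℂ) : maxEnt n ⬝ᵥ v = ∑ p, v (p, p) := by
  simp [dotProduct, maxEnt, Fintype.sum_prod_type]

lemma Q_mulVec (n : ℕ) (v : Fin n × Fin n → ℂ) :
    Qproj n *ᵥ v = v - ((1 / (n : ℂ)) * (maxEnt n ⬝ᵥ v)) • maxEnt n := by
  rw [Qproj, Matrix.sub_mulVec, Matrix.one_mulVec, Matrix.smul_mulVec, star_maxEnt,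
    Matrix.vecMulVec_mulVec]
  ext p
  simp
  ring

lemma maxEnt_self (n : ℕ) : maxEnt n ⬝ᵥ maxEnt n = n := by
  rw [maxEnt_dot]; simp [maxEnt]

lemma Q_maxEnt (n : ℕ) (hn : n ≠ 0) : Qproj n *ᵥ maxEnt n = 0 := by
  rw [Q_mulVec, maxEnt_self]
  have : (n : ℂ) ≠ 0 := by exact_mod_cast hn
  simp [this]

lemma star_dot_self {m : Type*} [Fintype m] (v : m → ℂ) :
    star v ⬝ᵥ v = ((∑ p, ‖v p‖ ^ 2 : ℝ) : ℂ) := by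
  simp [dotProduct, Complex.conj_mul']

lemma t_zero {n : ℕ} (hn : 2 ≤ n) (a b : Fin n → ℂ)
    (h : star (prodVec a b) ⬝ᵥ (Qproj n *ᵥ prodVec a b) = 0) :
    maxEnt n ⬝ᵥ prodVec a b = 0 := by
  have hC : (n : ℂ) ≠ 0 := by exact_mod_cast (by omega : n ≠ 0)
  set t := maxEnt n ⬝ᵥ prodVec a b with ht
  have hst : star (prodVec a b) ⬝ᵥ maxEnt n = star t := by
    rw [ht, ← star_maxEnt n, Matrix.star_dotProduct, star_star, star_maxEnt]
    
  rw [Q_mulVec, dotProduct_sub, dotProduct_smul, hst, star_dot_self, ← ht] at h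
  have h2 : (n : ℝ) * (∑ p, ‖prodVec a b p‖ ^ 2) = ‖t‖ ^ 2 := by
    have h3 : t * star t = ((‖t‖ ^ 2 : ℝ) : ℂ) := by
      simp [Complex.mul_conj']
    have : ((n : ℂ)) * ((∑ p, ‖prodVec a b p‖ ^ 2 : ℝ) : ℂ) = t * star t := by
      rw [smul_eq_mul] at h
      rw [sub_eq_zero.mp h]
      field_simp
    rw [h3] at this
    exact_mod_cast this
  have h4 : ∑ p, ‖prodVec a b p‖ ^ 2 = (∑ p, ‖a p‖ ^ 2) * ∑ p, ‖b p‖ ^ 2 := by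
    simp [prodVec, Fintype.sum_prod_type, Finset.sum_mul_sum, mul_pow]
  have h5 : ‖t‖ ≤ ∑ p, ‖a p‖ * ‖b p‖ := by
    rw [ht, maxEnt_dot]
    refine (norm_sum_le _ _).trans (le_of_eq ?_)
    simp [prodVec]
  have h6 : ‖t‖ ^ 2 ≤ (∑ p, ‖a p‖ ^ 2) * ∑ p, ‖b p‖ ^ 2 :=
    (pow_le_pow_left₀ (norm_nonneg _) h5 2).trans (Finset.sum_mul_sq_le_sq_mul_sq _ _ _)
  rw [← h4] at h6
  have hn' : (2 : ℝ) ≤ n := by exact_mod_cast hn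
  have h7 : ‖t‖ ^ 2 = 0 := by nlinarith [sq_nonneg ‖t‖]
  simpa using h7

theorem stmt5 (n N : ℕ) (hn : 2 ≤ n) (a b : Fin N → (Fin n → ℂ))
    (hsum : ∑ i, meas (a i) (b i) = (1 : Matrix (Fin n × Fin n) (Fin n × Fin n) ℂ)) :
    ∃ i j : Fin N, i ≠ j ∧
      star (prodVec (a i) (b i)) ⬝ᵥ (Qproj n *ᵥ prodVec (a j) (b j)) ≠ 0 := by
  by_contra hcon
  push Not at hcon
  have hw : ∑ j, (star (prodVec (a j) (b j)) ⬝ᵥ maxEnt n) • prodVec (a j) (b j) = maxEnt n := by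
    have := congrArg (fun M => M *ᵥ maxEnt n) hsum
    simp only [Matrix.sum_mulVec, meas_eq, Matrix.vecMulVec_mulVec, Matrix.one_mulVec] at this
    simp only [op_smul_eq_smul] at this
    exact this
  have hst : ∀ j, star (prodVec (a j) (b j)) ⬝ᵥ maxEnt n
      = star (maxEnt n ⬝ᵥ prodVec (a j) (b j)) := by
    intro j
    rw [← star_maxEnt n, Matrix.star_dotProduct, star_star, star_maxEnt]
  have ht : ∀ i, maxEnt n ⬝ᵥ prodVec (a i) (b i) = 0 := by
    intro i
    have h0 : star (prodVec (a i) (b i)) ⬝ᵥ (Qproj n *ᵥ maxEnt n) = 0 := by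
      rw [Q_maxEnt n (by omega), dotProduct_zero]
    rw [← hw, Matrix.mulVec_sum, dotProduct_sum, Finset.sum_eq_single i] at h0
    · rw [Matrix.mulVec_smul, dotProduct_smul, smul_eq_mul, mul_eq_zero] at h0
      rcases h0 with h0 | h0
      · rw [hst] at h0
        exact star_eq_zero.mp h0
      · exact t_zero hn _ _ h0
    · intro j _ hj
      rw [Matrix.mulVec_smul, dotProduct_smul, hcon i j hj.symm, smul_zero]
    · simp
  have hz : maxEnt n = 0 := by
    rw [← hw]
    exact Finset.sum_eq_zero fun j _ => by rw [hst, ht]; simp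
  have := maxEnt_self n
  rw [hz] at this
  simp at this
  have : n = 0 := by exact_mod_cast this.symm
  omega
end
end

section
/- Let n ≥ 3, let Q = I − (1/n)·w w* where w = Σ_{i=1}^n e_i⊗e_i ∈ ℂⁿ⊗ℂⁿ, and let a_i, b_i, a_j, b_j ∈ ℂⁿ be such that the vectors a_i ⊗ \bar{b_i} and a_j ⊗ \bar{b_j} are linearly independent in ℂⁿ⊗ℂⁿ. Then the vectors Q(a_i ⊗ \bar{b_i}) and Q(a_j ⊗ \bar{b_j}) are also linearly independent. -/
open Matrix BigOperators

noncomputable section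

theorem stmt7 (n : ℕ) (hn : 3 ≤ n) (ai bi aj bj : Fin n → ℂ)
    (h : LinearIndependent ℂ ![prodVec ai bi, prodVec aj bj]) :
    LinearIndependent ℂ ![Qproj n *ᵥ prodVec ai bi, Qproj n *ᵥ prodVec aj bj] := by
  rw [LinearIndependent.pair_iff] at h ⊢
  intro s t hst
  apply h s t
  have hQ : Qproj n *ᵥ (s • prodVec ai bi + t • prodVec aj bj) = 0 := by
    rw [Matrix.mulVec_add, Matrix.mulVec_smul, Matrix.mulVec_smul]
    exact hst
  obtain ⟨c, hc⟩ : ∃ c : ℂ, s • prodVec ai bi + t • prodVec aj bj = c • maxEnt n := by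
    generalize s • prodVec ai bi + t • prodVec aj bj = v at hQ
    refine ⟨(1 / (n : ℂ)) * (star (maxEnt n) ⬝ᵥ v), ?_⟩
    rw [Qproj, Matrix.sub_mulVec, Matrix.one_mulVec, Matrix.smul_mulVec,
      Matrix.vecMulVec_mulVec, sub_eq_zero] at hQ
    rw [mul_smul, ← op_smul_eq_smul (star (maxEnt n) ⬝ᵥ v)]
    exact hQ
  have key : ∀ p q : Fin n, s * (ai p * (starRingEnd ℂ) (bi q)) +
      t * (aj p * (starRingEnd ℂ) (bj q)) = c * (if p = q then 1 else 0) := by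
    intro p q
    have := congrFun hc (p, q)
    simpa only [prodVec, maxEnt, Pi.add_apply, Pi.smul_apply, smul_eq_mul] using this
  have hc0 : c = 0 := by
    have main : ∀ M : Fin n → Fin n → ℂ, (∀ p q, s * (ai p * (starRingEnd ℂ) (bi q)) +
        t * (aj p * (starRingEnd ℂ) (bj q)) = M p q) → ∀ x y z : Fin n,
        M x x * (M y y * M z z - M y z * M z y) - M x y * (M y x * M z z - M y z * M z x)
          + M x z * (M y x * M z y - M y y * M z x) = 0 := by
      intro M hM x y z
      simp only [← hM]
      ring
    have h3 := main _ key ⟨0, by omega⟩ ⟨1, by omega⟩ ⟨2, by omega⟩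
    simpa using h3
  rw [hc, hc0, zero_smul]
end
end

section
/- Let u be a unit vector in ℂ²⊗ℂ². Then there exist unit vectors a_1, b_1, a_2, b_2 ∈ ℂ² such that the set {u, a_1 ⊗ b_1, a_2 ⊗ b_2} is orthonormal in ℂ²⊗ℂ². -/
open Matrix BigOperators

noncomputable section

/-- The product vector `a ⊗ b ∈ ℂ² ⊗ ℂ² ≅ ℂ⁴` (Kronecker product of vectors). -/
def tensVec (a b : Fin 2 → ℂ) : Fin 2 × Fin 2 → ℂ := fun p => a p.1 * b p.2

/-- Every linear functional on `ℂ²` kills some unit vector. -/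
theorem exists_unit_ker (x y : ℂ) :
    ∃ b : Fin 2 → ℂ, star b ⬝ᵥ b = 1 ∧ x * b 0 + y * b 1 = 0 := by
  by_cases h : x = 0 ∧ y = 0
  · refine ⟨![1, 0], ?_, ?_⟩
    · simp [dotProduct, Fin.sum_univ_two]
    · simp [h.1, h.2]
  · have hpos : 0 < Complex.normSq x + Complex.normSq y := by
      rcases not_and_or.mp h with h | h
      · have := Complex.normSq_pos.mpr h
        have := Complex.normSq_nonneg y
        linarith
      · have := Complex.normSq_pos.mpr h
        have := Complex.normSq_nonneg x
        linarith
    set r : ℝ := Real.sqrt (Complex.normSq x + Complex.normSq y) with hr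
    have hr0 : (r : ℂ) ≠ 0 := by
      exact_mod_cast (Real.sqrt_pos.mpr hpos).ne'
    have hr2 : (r : ℂ) * r = star x * x + star y * y := by
      have h1 : r * r = Complex.normSq x + Complex.normSq y := Real.mul_self_sqrt hpos.le
      have h2 : (r : ℂ) * r = (Complex.normSq x : ℂ) + Complex.normSq y := by exact_mod_cast h1
      rw [h2, Complex.normSq_eq_conj_mul_self, Complex.normSq_eq_conj_mul_self]
      rfl
    refine ⟨![y / r, -x / r], ?_, ?_⟩
    · simp [dotProduct, Fin.sum_univ_two] at hr2 ⊢
      field_simp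
      linear_combination -hr2
    · simp
      ring

/-- Every unit vector `u ∈ ℂ² ⊗ ℂ²` can be extended by two product unit vectors
`a₁ ⊗ b₁` and `a₂ ⊗ b₂` so that `{u, a₁ ⊗ b₁, a₂ ⊗ b₂}` is orthonormal. -/
theorem stmt14 (u : Fin 2 × Fin 2 → ℂ) (hu : star u ⬝ᵥ u = 1) :
    ∃ a₁ b₁ a₂ b₂ : Fin 2 → ℂ,
      star a₁ ⬝ᵥ a₁ = 1 ∧ star b₁ ⬝ᵥ b₁ = 1 ∧ star a₂ ⬝ᵥ a₂ = 1 ∧ star b₂ ⬝ᵥ b₂ = 1 ∧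
      star (tensVec a₁ b₁) ⬝ᵥ tensVec a₁ b₁ = 1 ∧
      star (tensVec a₂ b₂) ⬝ᵥ tensVec a₂ b₂ = 1 ∧
      star u ⬝ᵥ tensVec a₁ b₁ = 0 ∧
      star u ⬝ᵥ tensVec a₂ b₂ = 0 ∧
      star (tensVec a₁ b₁) ⬝ᵥ tensVec a₂ b₂ = 0 := by
  obtain ⟨b₁, hb₁, h₁⟩ := exists_unit_ker (star (u (0, 0))) (star (u (0, 1)))
  obtain ⟨b₂, hb₂, h₂⟩ := exists_unit_ker (star (u (1, 0))) (star (u (1, 1)))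
  refine ⟨![1, 0], b₁, ![0, 1], b₂, ?_, hb₁, ?_, hb₂, ?_, ?_, ?_, ?_, ?_⟩ <;>
    simp [dotProduct, Fin.sum_univ_two, Fintype.sum_prod_type, tensVec] at hb₁ hb₂ h₁ h₂ ⊢ <;>
    assumption
end
end
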